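/- For every integer k ≥ 5, the wheel graph W_k on k vertices satisfies A_b(W_k) = 4. -/

import Mathlib

open SimpleGraph

namespace AcyclicB

variable {V : Type*}

/-- `c` is a proper vertex coloring of `G`. -/
def Proper (G : SimpleGraph V) (c : V → ℕ) : Prop :=
  ∀ ⦃u v : V⦄, G.Adj u v → c u ≠ c v

/-- `c` is an acyclic (proper) coloring of `G`: the subgraph induced by the union of
any two color classes is a forest. -/
def IsAcyclicColoring (G : SimpleGraph V) (c : V → ℕ) : Prop :=
  Proper G c ∧ ∀ i j : ℕ, (G.induce {v | c v = i ∨ c v = j}).IsAcyclic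

/-- The closed neighborhood of `v` in `G`. -/
def closedNbhd (G : SimpleGraph V) (v : V) : Set V :=
  insert v (G.neighborSet v)

/-- `c'` is obtained from the acyclic coloring `c` by an acyclic recoloring step removing
one color `i`: every vertex of a color different from `i` keeps its color, and every vertex
of color `i` receives a color (among the colors of `c`, different from `i`) that is absent
from its closed neighborhood; the resulting coloring is again acyclic. -/
def RecolorStep (G : SimpleGraph V) (c' c : V → ℕ) : Prop :=
  IsAcyclicColoring G c ∧ IsAcyclicColoring G c' ∧
  ∃ i ∈ Set.range c,
    (∀ v, c v ≠ i → c' v = c v) ∧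
    (∀ v, c v = i → c' v ∈ Set.range c ∧ c' v ≠ i ∧
      ∀ u ∈ closedNbhd G v, c u ≠ c' v)

/-- The strict partial order `≺ₐ` on acyclic colorings: the transitive closure of the
acyclic recoloring step relation. -/
def StrictOrder (G : SimpleGraph V) : (V → ℕ) → (V → ℕ) → Prop :=
  Relation.TransGen (RecolorStep G)

/-- `c` is a minimal element of `≺ₐ`: an acyclic coloring admitting no acyclic recoloring
step. -/
def IsMinimal (G : SimpleGraph V) (c : V → ℕ) : Prop :=
  IsAcyclicColoring G c ∧ ∀ c', ¬ RecolorStep G c' c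

/-- The number of colors used by `c`. -/
def ncolors [Fintype V] (c : V → ℕ) : ℕ :=
  (Finset.univ.image c).card

/-- The acyclic b-chromatic number of `G`: the maximum number of colors used by a minimal
element of `≺ₐ`. -/
noncomputable def Ab [Fintype V] (G : SimpleGraph V) : ℕ :=
  sSup { k | ∃ c : V → ℕ, IsMinimal G c ∧ ncolors c = k }

/-- The acyclic chromatic number of `G`: the minimum number of colors in an acyclic
proper coloring. -/
noncomputable def Achrom [Fintype V] (G : SimpleGraph V) : ℕ :=
  sInf { k | ∃ c : V → ℕ, IsAcyclicColoring G c ∧ ncolors c = k }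

/-- The join of two graphs: disjoint copies of `G` and `H` together with all edges
between them. -/
def join {α β : Type*} (G : SimpleGraph α) (H : SimpleGraph β) : SimpleGraph (α ⊕ β) where
  Adj x y :=
    match x, y with
    | Sum.inl a, Sum.inl a' => G.Adj a a'
    | Sum.inr b, Sum.inr b' => H.Adj b b'
    | Sum.inl _, Sum.inr _ => True
    | Sum.inr _, Sum.inl _ => True
  symm := by
    constructor
    rintro (a | b) (a' | b') h
    · exact G.adj_symm h
    · trivial
    · trivial
    · exact H.adj_symm h
  loopless := by
    constructor
    rintro (a | b) h
    · exact G.loopless.irrefl a h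
    · exact H.loopless.irrefl b h

end AcyclicB

namespace AcyclicB

/-- A graph is acyclic if its vertices can be ranked so that every vertex has at most one
neighbor of rank at least its own. -/
theorem isAcyclic_of_rank (G : SimpleGraph V) (f : V → ℕ)
    (h : ∀ ⦃v a b⦄, G.Adj v a → G.Adj v b → f v ≤ f a → f v ≤ f b → a = b) :
    G.IsAcyclic := by
  classical
  intro u p hp
  obtain ⟨v, hv, hmin⟩ := p.support.toFinset.exists_min_image f
    ⟨u, List.mem_toFinset.mpr p.start_mem_support⟩
  rw [List.mem_toFinset] at hv
  have hq : (p.rotate v hv).IsCycle := hp.rotate hv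
  have hle : ∀ w ∈ (p.rotate v hv).support, f v ≤ f w := fun w hw ↦
    hmin w (List.mem_toFinset.mpr ((p.mem_support_rotate_iff v hv).mp hw))
  exact hq.snd_ne_penultimate (h (Walk.adj_snd hq.not_nil) (Walk.adj_penultimate hq.not_nil).symm
    (hle _ (Walk.getVert_mem_support _ _)) (hle _ (Walk.getVert_mem_support _ _)))

/-- Deleting a vertex from a cycle leaves an acyclic graph. -/
theorem isAcyclic_induce_cycleGraph {n : ℕ} (x : Fin (n + 2)) :
    ((cycleGraph (n + 2)).induce {v | v ≠ x}).IsAcyclic := by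
  refine isAcyclic_of_rank _ (fun v ↦ (v.1 - x).val) ?_
  have key : ∀ v a : Fin (n + 2), a ≠ x → (cycleGraph (n + 2)).Adj v a → v ≠ x →
      (v - x).val ≤ (a - x).val → a = v + 1 := by
    intro v a ha hva hv hle
    rw [cycleGraph_adj] at hva
    rcases hva with h | h
    · exfalso
      have h1 : v - x = (a - x) + 1 := by rw [← h]; abel
      have h2 : v - x ≠ 0 := sub_ne_zero.mpr hv
      have h3 := Fin.val_add_one (a - x)
      rw [← h1] at h3
      split_ifs at h3
      · exact h2 (Fin.ext h3)
      · omega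
    · rw [← h]; abel
  rintro ⟨v, hv⟩ ⟨a, ha⟩ ⟨b, hb⟩ hva hvb hfa hfb
  exact Subtype.ext ((key v a ha hva hv hfa).trans (key v b hb hvb hv hfb).symm)

/-- The wheel with `n` rim vertices. -/
abbrev wheel (n : ℕ) : SimpleGraph (Fin 1 ⊕ Fin n) :=
  join (completeGraph (Fin 1)) (cycleGraph n)

theorem Proper.rim_ne_hub {n : ℕ} {c : Fin 1 ⊕ Fin n → ℕ} (hc : Proper (wheel n) c) (v : Fin n) :
    c (Sum.inr v) ≠ c (Sum.inl 0) :=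
  hc (u := Sum.inr v) (v := Sum.inl 0) trivial

/-- A proper coloring of a wheel with at least four colors is acyclic. -/
theorem Proper.isAcyclicColoring {n : ℕ} {c : Fin 1 ⊕ Fin (n + 2) → ℕ}
    (hc : Proper (wheel (n + 2)) c) (h4 : 4 ≤ ncolors c) :
    IsAcyclicColoring (wheel (n + 2)) c := by
  refine ⟨hc, fun i j ↦ ?_⟩
  by_cases hub : c (Sum.inl 0) = i ∨ c (Sum.inl 0) = j
  · refine (isAcyclic_starGraph
      (⟨Sum.inl 0, hub⟩ : {v | c v = i ∨ c v = j})).anti ?_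
    rintro ⟨u, hu⟩ ⟨v, hv⟩ huv
    have huv' : (wheel (n + 2)).Adj u v := huv
    have hne := huv.ne
    have huc := hc huv'
    rw [starGraph_adj]
    refine ⟨hne, ?_⟩
    rcases u with u | u
    · left; ext; simp [Subsingleton.elim u 0]
    rcases v with v | v
    · right; ext; simp [Subsingleton.elim v 0]
    have h1 := hc.rim_ne_hub u
    have h2 := hc.rim_ne_hub v
    simp only [Set.mem_ofPred_eq] at hu hv
    omega
  · obtain ⟨x, hxi, hxj⟩ : ∃ x : Fin (n + 2), c (Sum.inr x) ≠ i ∧ c (Sum.inr x) ≠ j := by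
      by_contra! hx
      have hsub : Finset.univ.image c ⊆ {c (Sum.inl 0), i, j} := by
        intro y hy
        obtain ⟨v, -, rfl⟩ := Finset.mem_image.mp hy
        rcases v with v | v
        · simp [Subsingleton.elim v 0]
        · have := hx v
          simp only [Finset.mem_insert, Finset.mem_singleton]
          tauto
      have h3 := (Finset.card_le_card hsub).trans Finset.card_le_three
      unfold ncolors at h4
      omega
    have hinl : ∀ v ∈ {v | c v = i ∨ c v = j}, ∃ w, v = Sum.inr w ∧ w ≠ x := by
      rintro (v | v) hv
      · rw [Subsingleton.elim v 0] at hv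
        exact absurd hv hub
      · refine ⟨v, rfl, ?_⟩
        rintro rfl
        exact hv.elim hxi hxj
    choose g hg hgx using hinl
    refine (isAcyclic_induce_cycleGraph x).comap
      (⟨fun v ↦ ⟨g v.1 v.2, hgx v.1 v.2⟩, ?_⟩ : _ →g _) ?_
    · rintro ⟨u, hu⟩ ⟨v, hv⟩ huv
      have huv' : (wheel (n + 2)).Adj u v := huv
      rw [hg u hu, hg v hv] at huv'
      exact huv'
    · rintro ⟨u, hu⟩ ⟨v, hv⟩ huv
      have huv' : g u hu = g v hv := congrArg Subtype.val huv
      ext1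
      change u = v
      rw [hg u hu, hg v hv, huv']

/-- An acyclic coloring of a wheel uses at least four colors. -/
theorem IsAcyclicColoring.four_le_ncolors {n : ℕ} (hn : 3 ≤ n) {c : Fin 1 ⊕ Fin n → ℕ}
    (hc : IsAcyclicColoring (wheel n) c) : 4 ≤ ncolors c := by
  by_contra! hlt
  have hmem : c (Sum.inl 0) ∈ Finset.univ.image c := Finset.mem_image_of_mem _ (Finset.mem_univ _)
  have hcard : ((Finset.univ.image c).erase (c (Sum.inl 0))).card ≤ 2 := by
    rw [Finset.card_erase_of_mem hmem]
    unfold ncolors at hlt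
    omega
  obtain ⟨i, j, hij⟩ : ∃ i j, (Finset.univ.image c).erase (c (Sum.inl 0)) ⊆ {i, j} := by
    obtain ⟨t, ht, ht2⟩ := Infinite.exists_superset_card_eq _ 2 hcard
    obtain ⟨i, j, -, rfl⟩ := Finset.card_eq_two.mp ht2
    exact ⟨i, j, ht⟩
  have hrim : ∀ v, c (Sum.inr v) = i ∨ c (Sum.inr v) = j := fun v ↦ by
    simpa using hij (Finset.mem_erase.mpr
      ⟨hc.1.rim_ne_hub v, Finset.mem_image_of_mem c (Finset.mem_univ (Sum.inr v))⟩)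
  refine isAcyclic_iff_free_cycleGraph.mp (hc.2 i j) n hn ⟨⟨⟨fun v ↦ ⟨Sum.inr v, hrim v⟩, ?_⟩, ?_⟩⟩
  · exact fun {u v} huv ↦ huv
  · intro u v huv
    exact Sum.inr_injective (congrArg Subtype.val huv)

/-- A recoloring step removes a color and introduces none. -/
theorem RecolorStep.ncolors_lt [Fintype V] {G : SimpleGraph V} {c' c : V → ℕ}
    (h : RecolorStep G c' c) : ncolors c' < ncolors c := by
  obtain ⟨-, -, i, ⟨w, rfl⟩, hother, hi⟩ := h
  refine Finset.card_lt_card (Finset.ssubset_iff_of_subset ?_ |>.mpr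
    ⟨c w, Finset.mem_image_of_mem c (Finset.mem_univ w), ?_⟩)
  · intro y hy
    obtain ⟨v, -, rfl⟩ := Finset.mem_image.mp hy
    by_cases hv : c v = c w
    · obtain ⟨u, hu⟩ := (hi v hv).1
      exact hu ▸ Finset.mem_image_of_mem c (Finset.mem_univ u)
    · exact hother v hv ▸ Finset.mem_image_of_mem c (Finset.mem_univ v)
  · intro hy
    obtain ⟨v, -, hv⟩ := Finset.mem_image.mp hy
    by_cases hvw : c v = c w
    · exact (hi v hvw).2.1 hv
    · exact hvw (hother v hvw ▸ hv)

/-- An acyclic coloring of a wheel with at least five colors admits a recoloring step. -/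
theorem IsAcyclicColoring.exists_recolorStep {n : ℕ} {c : Fin 1 ⊕ Fin (n + 2) → ℕ}
    (hc : IsAcyclicColoring (wheel (n + 2)) c) (h5 : 5 ≤ ncolors c) :
    ∃ c', RecolorStep (wheel (n + 2)) c' c := by
  set i := c (Sum.inr 0) with hidef
  have hex : ∀ v : Fin (n + 2), ∃ y ∈ Finset.univ.image c, c (Sum.inr v) = i →
      y ≠ i ∧ ∀ u ∈ closedNbhd (wheel (n + 2)) (Sum.inr v), c u ≠ y := by
    intro v
    have hlt : ({c (Sum.inl 0), c (Sum.inr v), c (Sum.inr (v - 1)), c (Sum.inr (v + 1))} :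
        Finset ℕ).card < (Finset.univ.image c).card :=
      Finset.card_le_four.trans_lt h5
    obtain ⟨y, hy, hy'⟩ := Finset.exists_mem_notMem_of_card_lt_card hlt
    simp only [Finset.mem_insert, Finset.mem_singleton, not_or] at hy'
    obtain ⟨y0, y1, y2, y3⟩ := hy'
    refine ⟨y, hy, fun hv ↦ ⟨hv ▸ y1, ?_⟩⟩
    rintro (u | u) hu
    · rw [Subsingleton.elim u 0]
      exact Ne.symm y0
    · rcases hu with hu | hu
      · rw [hu]; exact Ne.symm y1
      · have hu' : (cycleGraph (n + 2)).Adj v u := hu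
        rw [cycleGraph_adj] at hu'
        rcases hu' with hu' | hu'
        · have : u = v - 1 := by rw [← hu']; abel
          rw [this]; exact Ne.symm y2
        · have : u = v + 1 := by rw [← hu']; abel
          rw [this]; exact Ne.symm y3
  choose g hgmem hg using hex
  let c' : Fin 1 ⊕ Fin (n + 2) → ℕ :=
    Sum.elim (fun a ↦ c (Sum.inl a)) fun v ↦ if c (Sum.inr v) = i then g v else c (Sum.inr v)
  have hother : ∀ v, c v ≠ i → c' v = c v := by
    rintro (v | v) hv
    · rfl
    · simp [c', hv]
  have hi : ∀ v, c v = i → c' v ∈ Set.range c ∧ c' v ≠ i ∧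
      ∀ u ∈ closedNbhd (wheel (n + 2)) v, c u ≠ c' v := by
    rintro (v | v) hv
    · rw [Subsingleton.elim v 0] at hv
      exact absurd hv.symm (hc.1.rim_ne_hub 0)
    · have hv' : c' (Sum.inr v) = g v := by simp [c', hv]
      rw [hv']
      exact ⟨by simpa using hgmem v, hg v hv⟩
  have hproper : Proper (wheel (n + 2)) c' := by
    intro u v huv
    by_cases hu : c u = i
    · have hv : c v ≠ i := fun hv ↦ hc.1 huv (hu.trans hv.symm)
      rw [hother v hv]
      exact ((hi u hu).2.2 v (Or.inr huv)).symm
    · rw [hother u hu]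
      by_cases hv : c v = i
      · exact (hi v hv).2.2 u (Or.inr huv.symm)
      · rw [hother v hv]
        exact hc.1 huv
  have hsub : (Finset.univ.image c).erase i ⊆ Finset.univ.image c' := by
    intro y hy
    obtain ⟨hyi, hy⟩ := Finset.mem_erase.mp hy
    obtain ⟨v, -, rfl⟩ := Finset.mem_image.mp hy
    exact hother v hyi ▸ Finset.mem_image_of_mem c' (Finset.mem_univ v)
  have h4 : 4 ≤ ncolors c' := by
    have h1 := Finset.card_le_card hsub
    have h2 := Finset.pred_card_le_card_erase (s := Finset.univ.image c) (a := i)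
    unfold ncolors at h5 ⊢
    omega
  exact ⟨c', hc, hproper.isAcyclicColoring h4, i, ⟨Sum.inr 0, rfl⟩, hother, hi⟩

/-- A proper coloring of the wheel with four colors. -/
def wheelColoring (n : ℕ) : Fin 1 ⊕ Fin n → ℕ :=
  Sum.elim (fun _ ↦ 0) fun v ↦ if v.val = 0 then 3 else 1 + v.val % 2

theorem proper_wheelColoring (n : ℕ) : Proper (wheel (n + 2)) (wheelColoring (n + 2)) := by
  have succ : ∀ v : Fin (n + 2),
      wheelColoring (n + 2) (Sum.inr v) ≠ wheelColoring (n + 2) (Sum.inr (v + 1)) := by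
    intro v
    have h := Fin.val_add_one v
    simp only [wheelColoring, Sum.elim_inr]
    split_ifs at h with hl
    · have hv : v.val = n + 1 := congrArg Fin.val hl
      simp only [h, hv]
      split_ifs <;> first | contradiction | omega
    · simp only [h]
      split_ifs <;> first | contradiction | omega
  rintro (u | u) (v | v) huv
  · exact absurd (Subsingleton.elim u v) (Adj.ne (G := completeGraph (Fin 1)) huv)
  · simp only [wheelColoring, Sum.elim_inl, Sum.elim_inr]
    split_ifs <;> omega
  · simp only [wheelColoring, Sum.elim_inl, Sum.elim_inr]
    split_ifs <;> omega
  · have huv' : (cycleGraph (n + 2)).Adj u v := huv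
    rw [cycleGraph_adj] at huv'
    rcases huv' with h | h
    · have : u = v + 1 := by rw [← h]; abel
      rw [this]
      exact (succ v).symm
    · have : v = u + 1 := by rw [← h]; abel
      rw [this]
      exact succ u

theorem ncolors_wheelColoring {n : ℕ} (hn : 3 ≤ n) : ncolors (wheelColoring n) = 4 := by
  have himage : Finset.univ.image (wheelColoring n) = Finset.range 4 := by
    ext y
    simp only [Finset.mem_image, Finset.mem_univ, true_and, Finset.mem_range]
    constructor
    · rintro ⟨v | v, rfl⟩
      · simp [wheelColoring]
      · simp only [wheelColoring, Sum.elim_inr]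
        split_ifs <;> omega
    · intro hy
      interval_cases y
      · exact ⟨Sum.inl 0, rfl⟩
      · exact ⟨Sum.inr ⟨2, by omega⟩, by simp [wheelColoring]⟩
      · exact ⟨Sum.inr ⟨1, by omega⟩, by simp [wheelColoring]⟩
      · exact ⟨Sum.inr ⟨0, by omega⟩, by simp [wheelColoring]⟩
  rw [ncolors, himage, Finset.card_range]

/-- For every `k ≥ 5`, the wheel `W_k = K₁ ∨ C_{k−1}` on `k` vertices satisfies
`A_b(W_k) = 4`. -/
theorem ab_wheel (k : ℕ) (hk : 5 ≤ k) :
    Ab (join (completeGraph (Fin 1)) (SimpleGraph.cycleGraph (k - 1))) = 4 := by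
  obtain ⟨n, hn⟩ : ∃ n, k - 1 = n + 2 := ⟨k - 3, by omega⟩
  have hn3 : 3 ≤ n + 2 := by omega
  rw [hn]
  refine IsGreatest.csSup_eq ⟨⟨wheelColoring (n + 2), ⟨?_, fun c' h ↦ ?_⟩,
    ncolors_wheelColoring hn3⟩, ?_⟩
  · exact (proper_wheelColoring n).isAcyclicColoring (ncolors_wheelColoring hn3).ge
  · have hlt := h.ncolors_lt
    have hge := h.2.1.four_le_ncolors hn3
    rw [ncolors_wheelColoring hn3] at hlt
    omega
  · rintro m ⟨c, ⟨hc, hmin⟩, rfl⟩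
    by_contra! hlt
    obtain ⟨c', h⟩ := hc.exists_recolorStep hlt
    exact hmin c' h

end AcyclicB
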